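/- Let F be a field, σ : F → F a field automorphism of finite order m, n ≤ m, h = (h_1,…,h_n) ∈ F^n a vector with entries linearly independent over F^σ, T ⊆ ℤ, and y ∈ F^n. For d ∈ ℤ set S_d = Σ_{j=1}^n y_j σ^d(h_j). Then for every natural number ν, the following are equivalent: (a) there exist c ∈ C_(σ,h,T) and e ∈ F^n with y = c + e and rkw(e) = ν; (b) there exist ε = (ε_1,…,ε_ν) and η = (η_1,…,η_ν) in F^ν such that the entries of ε are linearly independent over F^σ, the entries of η are linearly independent over F^σ and each η_k lies in the F^σ-linear span of the entries of h, and S_d = Σ_{k=1}^ν ε_k·σ^d(η_k) for all d ∈ T. -/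

import Mathlib

/-- The fixed subfield of a field automorphism `σ : F ≃+* F`. -/
def fixedField {F : Type*} [Field F] (σ : F ≃+* F) : Subfield F where
  carrier := {x | σ x = x}
  mul_mem' := by
    intro a b ha hb
    simp only [Set.mem_setOf_eq] at *
    rw [map_mul, ha, hb]
  one_mem' := by simp only [Set.mem_setOf_eq, map_one]
  add_mem' := by
    intro a b ha hb
    simp only [Set.mem_setOf_eq] at *
    rw [map_add, ha, hb]
  zero_mem' := by simp only [Set.mem_setOf_eq, map_zero]
  neg_mem' := by
    intro a ha
    simp only [Set.mem_setOf_eq] at *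
    rw [map_neg, ha]
  inv_mem' := by
    intro a ha
    simp only [Set.mem_setOf_eq] at *
    rw [map_inv₀, ha]

/-- The code `C_(σ,h,T)`. -/
def code {F : Type*} [Field F] {ι : Type*} [Fintype ι] (σ : F ≃+* F) (h : ι → F)
    (T : Set ℤ) : Set (ι → F) :=
  {v : ι → F | ∀ i ∈ T, ∑ j, v j * (σ ^ i) (h j) = 0}

/-- The rank weight of a vector. -/
noncomputable def rankWeight {F : Type*} [Field F] (σ : F ≃+* F) {n : ℕ} (v : Fin n → F) : ℕ :=
  Module.finrank (fixedField σ) (Submodule.span (fixedField σ) (Set.range v))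
theorem zpow_apply_of_mem_fixedField {F : Type*} [Field F] (σ : F ≃+* F) {x : F}
    (hx : x ∈ fixedField σ) (d : ℤ) : (σ ^ d) x = x := by
  have hσ : σ ∈ MulAction.stabilizer (RingAut F) x := hx
  exact (MulAction.stabilizer (RingAut F) x).zpow_mem hσ d

/-- The rank weight of a linear combination of independent elements is the rank of the
coefficient matrix. -/
theorem rankWeight_linearCombination {F : Type*} [Field F] (σ : F ≃+* F) {n ν : ℕ}
    {ε : Fin ν → F} (hε : LinearIndependent (fixedField σ) ε)
    (A : Matrix (Fin ν) (Fin n) (fixedField σ)) :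
    rankWeight σ (fun j => ∑ k, A k j • ε k) = A.rank := by
  have hinj : Function.Injective (Fintype.linearCombination (fixedField σ) ε) :=
    linearIndependent_iff_injective_fintypeLinearCombination.mp hε
  have hcols : (fun j => ∑ k, A k j • ε k) =
      Fintype.linearCombination (fixedField σ) ε ∘ A.col := by
    ext j
    exact (Fintype.linearCombination_apply (fixedField σ) ε (A.col j)).symm
  rw [rankWeight, hcols, Set.range_comp, ← Submodule.map_span,
    ← (Submodule.equivMapOfInjective _ hinj _).finrank_eq, Matrix.rank_eq_finrank_span_cols]

theorem linearIndependent_row_iff_rank_eq {K : Type*} [Field K] {n ν : ℕ}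
    (A : Matrix (Fin ν) (Fin n) K) : LinearIndependent K A.row ↔ A.rank = ν := by
  rw [linearIndependent_iff_card_eq_finrank_span, Set.finrank, ← Matrix.rank_eq_finrank_span_row,
    Fintype.card_fin, eq_comm]

theorem linearIndependent_linearCombination_iff {K V : Type*} [Field K] [AddCommGroup V]
    [Module K V] {n ν : ℕ} {h : Fin n → V} (hh : LinearIndependent K h)
    (A : Matrix (Fin ν) (Fin n) K) :
    LinearIndependent K (fun k => ∑ j, A k j • h j) ↔ LinearIndependent K A.row :=
  LinearMap.linearIndependent_iff_of_injOn (v := A.row) (Fintype.linearCombination K h)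
    (linearIndependent_iff_injective_fintypeLinearCombination.mp hh).injOn

/-- The syndromes of an error vector with coefficient matrix `A`. -/
theorem sum_linearCombination_mul_zpow {F : Type*} [Field F] (σ : F ≃+* F) {n ν : ℕ}
    (h : Fin n → F) (ε : Fin ν → F) (A : Matrix (Fin ν) (Fin n) (fixedField σ)) (d : ℤ) :
    ∑ j, (∑ k, A k j • ε k) * (σ ^ d) (h j) =
      ∑ k, ε k * (σ ^ d) (∑ j, A k j • h j) := by
  simp only [Subfield.smul_def, smul_eq_mul, map_sum, map_mul,
    zpow_apply_of_mem_fixedField σ (Subtype.property _), Finset.sum_mul, Finset.mul_sum]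
  rw [Finset.sum_comm]
  refine Finset.sum_congr rfl fun k _ => Finset.sum_congr rfl fun j _ => ?_
  ring

/-- Decompositions `y = c + e` with `c ∈ C_(σ,h,T)` and `rkw e = ν` correspond to
relevant solutions of the syndrome equations of length `ν`. -/
theorem decomposition_iff_relevant_solution {F : Type*} [Field F]
    (σ : F ≃+* F) (m : ℕ) (hm0 : 0 < m) (hord : orderOf σ = m)
    {n : ℕ} (hn : n ≤ m) (h : Fin n → F)
    (hh : LinearIndependent (fixedField σ) h)
    (T : Set ℤ) (y : Fin n → F) (ν : ℕ) :
    (∃ c e : Fin n → F, c ∈ code σ h T ∧ y = c + e ∧ rankWeight σ e = ν)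
    ↔
    (∃ ε η : Fin ν → F,
      LinearIndependent (fixedField σ) ε ∧
      LinearIndependent (fixedField σ) η ∧
      (∀ k, η k ∈ Submodule.span (fixedField σ) (Set.range h)) ∧
      ∀ d ∈ T, ∑ j, y j * (σ ^ d) (h j) = ∑ k, ε k * (σ ^ d) (η k)) := by
  constructor
  · rintro ⟨c, e, hc, rfl, he⟩
    have : Module.Finite (fixedField σ) (Submodule.span (fixedField σ) (Set.range e)) :=
      Module.Finite.span_of_finite _ (Set.finite_range e)
    obtain ⟨b⟩ : Nonempty (Module.Basis (Fin ν) (fixedField σ)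
        (Submodule.span (fixedField σ) (Set.range e))) :=
      ⟨Module.finBasisOfFinrankEq _ _ he⟩
    let ε : Fin ν → F := fun k => b k
    have hε : LinearIndependent (fixedField σ) ε :=
      b.linearIndependent.map' (Submodule.subtype _) (Submodule.ker_subtype _)
    let A : Matrix (Fin ν) (Fin n) (fixedField σ) := Matrix.of fun k j =>
      b.repr ⟨e j, Submodule.subset_span (Set.mem_range_self j)⟩ k
    have heA : e = fun j => ∑ k, A k j • ε k := by
      ext j
      have hj := congrArg Subtype.val
        (b.sum_repr ⟨e j, Submodule.subset_span (Set.mem_range_self j)⟩)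
      rw [Submodule.coe_sum] at hj
      exact hj.symm
    have hA : A.rank = ν := by
      rw [← rankWeight_linearCombination σ hε A, ← heA, he]
    refine ⟨ε, fun k => ∑ j, A k j • h j, hε, ?_, fun k => ?_, fun d hd => ?_⟩
    · rwa [linearIndependent_linearCombination_iff hh, linearIndependent_row_iff_rank_eq]
    · exact Submodule.sum_mem _ fun j _ =>
        Submodule.smul_mem _ _ (Submodule.subset_span (Set.mem_range_self j))
    · have hcd := hc d hd
      rw [← sum_linearCombination_mul_zpow]
      simp only [Pi.add_apply, add_mul, Finset.sum_add_distrib, hcd, zero_add]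
      rw [heA]
  · rintro ⟨ε, η, hε, hη, hspan, hS⟩
    choose a ha using fun k => (Submodule.mem_span_range_iff_exists_fun _).mp (hspan k)
    let A : Matrix (Fin ν) (Fin n) (fixedField σ) := Matrix.of a
    obtain rfl : (fun k => ∑ j, A k j • h j) = η := funext ha
    let e : Fin n → F := fun j => ∑ k, A k j • ε k
    refine ⟨y - e, e, fun d hd => ?_, (sub_add_cancel y e).symm, ?_⟩
    · simp only [Pi.sub_apply, sub_mul, Finset.sum_sub_distrib, hS d hd, sub_eq_zero]
      exact (sum_linearCombination_mul_zpow σ h ε A d).symm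
    · rw [linearIndependent_linearCombination_iff hh A, linearIndependent_row_iff_rank_eq] at hη
      exact (rankWeight_linearCombination σ hε A).trans hη
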